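/- arXiv:2511.12315 — 2 statements merged into one kernel-verified Lean document; each statement's English description precedes it below -/
import Mathlib

section
/- For every vertex q of the Stern–Brocot tree with boundary triple (l, q, r) ∈ B, the set of vertices of the subtree rooted at q (that is, q together with all its descendants in T_SB) is exactly {p ∈ ℚ : l < p < r}. -/
/-- Fractions are pairs `(numerator, denominator)` of integers; `(-1,0)` is `-∞`, `(1,0)` is `∞`. -/
def mediant (p q : ℤ × ℤ) : ℤ × ℤ := (p.1 + q.1, p.2 + q.2)

/-- The Stern–Brocot boundary relation `B`: `SBB l m r` means `(l, m, r) ∈ B`. -/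
inductive SBB : ℤ × ℤ → ℤ × ℤ → ℤ × ℤ → Prop
  | base : SBB (-1, 0) (0, 1) (1, 0)
  | left {l m r : ℤ × ℤ} : SBB l m r → SBB l (mediant l m) m
  | right {l m r : ℤ × ℤ} : SBB l m r → SBB m (mediant m r) r

/-- One step down the Stern–Brocot tree; the state is the triple
(left bound, node, right bound); `false` is an L-move, `true` an R-move. -/
def sbStep : (ℤ × ℤ) × (ℤ × ℤ) × (ℤ × ℤ) → Bool → (ℤ × ℤ) × (ℤ × ℤ) × (ℤ × ℤ)
  | (l, m, _r), false => (l, mediant l m, m)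
  | (_l, m, r), true => (m, mediant m r, r)

/-- Boundary triple of the node reached from the root `0/1` by the path `s ∈ {L,R}*`. -/
def sbTriple (s : List Bool) : (ℤ × ℤ) × (ℤ × ℤ) × (ℤ × ℤ) :=
  s.foldl sbStep ((-1, 0), (0, 1), (1, 0))

/-- The (numerator, denominator) of the node reached by the path `s`. -/
def sbNode (s : List Bool) : ℤ × ℤ := (sbTriple s).2.1

/-- The rational number at the node of the Stern–Brocot tree reached by the path `s`. -/
def sbVal (s : List Bool) : ℚ := ((sbNode s).1 : ℚ) / ((sbNode s).2 : ℚ)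

/-- The path (string in {L,R}*) whose run-length encoding is the block list `l`,
the first block being in direction `b` (`true` = R, `false` = L). -/
def pathOf (b : Bool) : List ℕ → List Bool
  | [] => []
  | a :: rest => List.replicate a b ++ pathOf (!b) rest

/-- `s` is the path of a convergent fraction of the node with path `t`:
either `s = t`, or `s` corresponds to the first `m` blocks (1 ≤ m ≤ n) of the
run-length (SB-)encoding of `t`. -/
def ConvPath (s t : List Bool) : Prop :=
  s = t ∨ ∃ (b : Bool) (l : List ℕ) (m : ℕ),
    (∀ a ∈ l, 0 < a) ∧ 0 < m ∧ m ≤ l.length ∧ t = pathOf b l ∧ s = pathOf b (l.take m)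

/-- `s` is the path of a strict convergent fraction of the node with path `t`. -/
def StrictConvPath (s t : List Bool) : Prop :=
  ∃ (b : Bool) (l : List ℕ) (m : ℕ),
    (∀ a ∈ l, 0 < a) ∧ 0 < m ∧ m < l.length ∧ t = pathOf b l ∧ s = pathOf b (l.take m)

/-- `p` is a convergent fraction of `r` in the Stern–Brocot tree. -/
def ConvOf (p r : ℚ) : Prop := ∃ s t : List Bool, sbVal s = p ∧ sbVal t = r ∧ ConvPath s t

/-- `r` is a (strict) ancestor of `p` in the Stern–Brocot tree, i.e. `p` is a descendant of `r`. -/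
def IsAncestor (r p : ℚ) : Prop := ∃ s t : List Bool, sbVal s = r ∧ t ≠ [] ∧ sbVal (s ++ t) = p

/-- `(p, q)` is an edge of the Stern–Brocot tree, `q` a child of `p`. -/
def IsEdge (p q : ℚ) : Prop := ∃ (s : List Bool) (d : Bool), sbVal s = p ∧ sbVal (s ++ [d]) = q

/-- An interval of `ℚ`: a nonempty order-convex set. -/
def IsInterval (I : Set ℚ) : Prop :=
  I.Nonempty ∧ ∀ p ∈ I, ∀ q ∈ I, ∀ r : ℚ, p < r → r < q → r ∈ I

/-- An interval partition of `ℚ`: a list of intervals, pointwise increasing, covering `ℚ`. -/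
def IsIntervalPartition (P : List (Set ℚ)) : Prop :=
  (∀ I ∈ P, IsInterval I) ∧
  P.Pairwise (fun I J => ∀ p ∈ I, ∀ q ∈ J, p < q) ∧
  (∀ x : ℚ, ∃ I ∈ P, x ∈ I)

/-- `I` is monochromatic with respect to `γ`: `γ` is constant on `I`. -/
def Monochromatic {S : Type*} (γ : ℚ → S) (I : Set ℚ) : Prop :=
  ∀ p ∈ I, ∀ q ∈ I, γ p = γ q

/-- `γ` is a finite piecewise function. -/
def FinitePW {S : Type*} (γ : ℚ → S) : Prop :=
  ∃ P : List (Set ℚ), IsIntervalPartition P ∧ ∀ I ∈ P, Monochromatic γ I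

/-- `P` is the canonical representation of `γ`: an interval partition into monochromatic
pieces on which `γ` takes different constant values on adjacent pieces. -/
def IsCanonicalRep {S : Type*} (γ : ℚ → S) (P : List (Set ℚ)) : Prop :=
  IsIntervalPartition P ∧ (∀ I ∈ P, Monochromatic γ I) ∧
  P.Chain' (fun I J => ∀ p ∈ I, ∀ q ∈ J, γ p ≠ γ q)

/-- `x ∈ bounds(γ)`: `x` is a (rational) infimum or supremum of an interval of the
canonical representation of `γ`. -/
def IsBound {S : Type*} (γ : ℚ → S) (x : ℚ) : Prop :=
  ∃ P, IsCanonicalRep γ P ∧ ∃ I ∈ P, IsGLB I x ∨ IsLUB I x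

/-- `x` is a left-bound of `γ`: the minimum of some interval of the canonical representation. -/
def IsLeftBound {S : Type*} (γ : ℚ → S) (x : ℚ) : Prop :=
  ∃ P, IsCanonicalRep γ P ∧ ∃ I ∈ P, IsLeast I x

/-- `x` is a right-bound of `γ`: the maximum of some interval of the canonical representation. -/
def IsRightBound {S : Type*} (γ : ℚ → S) (x : ℚ) : Prop :=
  ∃ P, IsCanonicalRep γ P ∧ ∃ I ∈ P, IsGreatest I x

/-- `(p, q)` is a break link of `γ`: an edge of the Stern–Brocot tree such that `p = 0/1`
or the unordered closed interval `⟦p, q⟧` is not monochromatic w.r.t. `γ`. -/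
def IsBreakLink {S : Type*} (γ : ℚ → S) (p q : ℚ) : Prop :=
  IsEdge p q ∧ (p = 0 ∨ ¬ Monochromatic γ (Set.uIcc p q))

/-- `cfval [a₁,…,aₙ] = a₁ + 1/(a₂ + 1/(⋯ + 1/(aₙ + 1)))`. -/
def cfval : List ℕ → ℚ
  | [] => 1
  | [a] => (a : ℚ) + 1
  | a :: b :: rest => (a : ℚ) + 1 / cfval (b :: rest)

/-- The invariant of the boundary triples of the Stern–Brocot tree: denominators are nonnegative
(positive for the node itself) and neighbouring fractions have determinant one. -/
structure IsUnimodularTriple (T : (ℤ × ℤ) × (ℤ × ℤ) × (ℤ × ℤ)) : Prop where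
  left_nonneg : 0 ≤ T.1.2
  node_pos : 0 < T.2.1.2
  right_nonneg : 0 ≤ T.2.2.2
  det_left : T.2.1.1 * T.1.2 - T.1.1 * T.2.1.2 = 1
  det_right : T.2.2.1 * T.2.1.2 - T.2.1.1 * T.2.2.2 = 1

/-- `a / b` (with `b > 0`) lies strictly between the outer fractions of the triple `T`. -/
def LiesBetween (T : (ℤ × ℤ) × (ℤ × ℤ) × (ℤ × ℤ)) (a b : ℤ) : Prop :=
  T.1.1 * b < a * T.1.2 ∧ a * T.2.2.2 < T.2.2.1 * b

theorem IsUnimodularTriple.step {T : (ℤ × ℤ) × (ℤ × ℤ) × (ℤ × ℤ)}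
    (h : IsUnimodularTriple T) (d : Bool) : IsUnimodularTriple (sbStep T d) := by
  obtain ⟨⟨l₁, l₂⟩, ⟨m₁, m₂⟩, ⟨r₁, r₂⟩⟩ := T
  obtain ⟨hl, hm, hr, hd, hd'⟩ := h
  dsimp only at *
  cases d <;> constructor <;> simp only [sbStep, mediant] <;> linarith

theorem IsUnimodularTriple.foldl {T : (ℤ × ℤ) × (ℤ × ℤ) × (ℤ × ℤ)}
    (h : IsUnimodularTriple T) (t : List Bool) : IsUnimodularTriple (t.foldl sbStep T) := by
  induction t generalizing T with
  | nil => exact h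
  | cons d t ih => exact ih (h.step d)

theorem isUnimodularTriple_sbTriple (s : List Bool) : IsUnimodularTriple (sbTriple s) :=
  IsUnimodularTriple.foldl (by constructor <;> norm_num) s

theorem sbTriple_append (s t : List Bool) : sbTriple (s ++ t) = t.foldl sbStep (sbTriple s) :=
  List.foldl_append

theorem LiesBetween.of_step {T : (ℤ × ℤ) × (ℤ × ℤ) × (ℤ × ℤ)} (h : IsUnimodularTriple T)
    {d : Bool} {a b : ℤ} (hb : 0 < b) (hab : LiesBetween (sbStep T d) a b) :
    LiesBetween T a b := by
  obtain ⟨⟨l₁, l₂⟩, ⟨m₁, m₂⟩, ⟨r₁, r₂⟩⟩ := T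
  obtain ⟨hl, hm, hr, hd, hd'⟩ := h
  cases d <;> simp only [LiesBetween, sbStep] at * <;> obtain ⟨h₁, h₂⟩ := hab
  · refine ⟨h₁, lt_of_mul_lt_mul_right ?_ hm.le⟩
    linear_combination r₂ * h₂.le + hb - b * hd'
  · refine ⟨lt_of_mul_lt_mul_right ?_ hm.le, h₂⟩
    linear_combination l₂ * h₁.le + hb - b * hd

theorem IsUnimodularTriple.liesBetween_node {T : (ℤ × ℤ) × (ℤ × ℤ) × (ℤ × ℤ)}
    (h : IsUnimodularTriple T) {a b : ℤ} (hb : 0 < b) (hab : T.2.1.1 * b = a * T.2.1.2) :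
    LiesBetween T a b := by
  obtain ⟨hl, hm, hr, hd, hd'⟩ := h
  constructor <;> refine lt_of_mul_lt_mul_right ?_ hm.le
  · linear_combination hb - b * hd + T.1.2 * hab
  · linear_combination hb - b * hd' - T.2.2.2 * hab

theorem IsUnimodularTriple.liesBetween_of_foldl_node {T : (ℤ × ℤ) × (ℤ × ℤ) × (ℤ × ℤ)}
    (h : IsUnimodularTriple T) {a b : ℤ} (hb : 0 < b) (t : List Bool)
    (hab : (t.foldl sbStep T).2.1.1 * b = a * (t.foldl sbStep T).2.1.2) :
    LiesBetween T a b := by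
  induction t generalizing T with
  | nil => exact h.liesBetween_node hb hab
  | cons d t ih => exact .of_step h hb (ih (h.step d) hab)

/-- A fraction between the outer fractions is the node itself or lies on one side of it. -/
theorem LiesBetween.node_or_step {T : (ℤ × ℤ) × (ℤ × ℤ) × (ℤ × ℤ)} {a b : ℤ}
    (hab : LiesBetween T a b) :
    T.2.1.1 * b = a * T.2.1.2 ∨ ∃ d, LiesBetween (sbStep T d) a b := by
  rcases lt_trichotomy (T.2.1.1 * b) (a * T.2.1.2) with h | h | h
  · exact .inr ⟨true, h, hab.2⟩
  · exact .inl h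
  · exact .inr ⟨false, hab.1, h⟩

theorem sbStep_node_eq_mediant (T : (ℤ × ℤ) × (ℤ × ℤ) × (ℤ × ℤ)) (d : Bool) :
    (sbStep T d).2.1 = mediant (sbStep T d).1 (sbStep T d).2.2 := by
  cases d <;> rfl

theorem LiesBetween.exists_foldl_of_eq_mediant {a b : ℤ} (n : ℕ)
    {T : (ℤ × ℤ) × (ℤ × ℤ) × (ℤ × ℤ)} (hT : T.2.1 = mediant T.1 T.2.2)
    (hab : LiesBetween T a b)
    (hn : (a * T.1.2 - T.1.1 * b) + (T.2.2.1 * b - a * T.2.2.2) ≤ n) :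
    ∃ t : List Bool, (t.foldl sbStep T).2.1.1 * b = a * (t.foldl sbStep T).2.1.2 := by
  induction n generalizing T with
  | zero => obtain ⟨h₁, h₂⟩ := hab; push_cast at hn; linarith
  | succ n ih =>
    rcases hab.node_or_step with h | ⟨d, hd⟩
    · exact ⟨[], h⟩
    · obtain ⟨t, ht⟩ := ih (sbStep_node_eq_mediant T d) hd (by
        obtain ⟨⟨l₁, l₂⟩, m, ⟨r₁, r₂⟩⟩ := T
        obtain rfl : m = mediant (l₁, l₂) (r₁, r₂) := hT
        obtain ⟨h₁, h₂⟩ := hab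
        cases d <;> simp only [sbStep, mediant] at * <;> push_cast at hn <;> linarith)
      exact ⟨d :: t, ht⟩

theorem LiesBetween.exists_foldl {a b : ℤ} {T : (ℤ × ℤ) × (ℤ × ℤ) × (ℤ × ℤ)}
    (hab : LiesBetween T a b) :
    ∃ t : List Bool, (t.foldl sbStep T).2.1.1 * b = a * (t.foldl sbStep T).2.1.2 := by
  rcases hab.node_or_step with h | ⟨d, hd⟩
  · exact ⟨[], h⟩
  · obtain ⟨t, ht⟩ := hd.exists_foldl_of_eq_mediant _ (sbStep_node_eq_mediant T d)
      (Int.self_le_toNat _)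
    exact ⟨d :: t, ht⟩

theorem sbVal_eq_iff (s : List Bool) (p : ℚ) :
    sbVal s = p ↔ (sbTriple s).2.1.1 * (p.den : ℤ) = p.num * (sbTriple s).2.1.2 := by
  have hm : ((sbTriple s).2.1.2 : ℚ) ≠ 0 :=
    Int.cast_ne_zero.2 (isUnimodularTriple_sbTriple s).node_pos.ne'
  have hp : (p.den : ℚ) ≠ 0 := Nat.cast_ne_zero.2 p.den_nz
  conv_lhs => rw [← Rat.num_div_den p, sbVal, sbNode, div_eq_div_iff hm hp]
  exact_mod_cast Iff.rfl

theorem liesBetween_num_den_iff (T : (ℤ × ℤ) × (ℤ × ℤ) × (ℤ × ℤ)) (p : ℚ) :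
    LiesBetween T p.num p.den ↔
      (T.1.1 : ℚ) < p * (T.1.2 : ℚ) ∧ p * (T.2.2.2 : ℚ) < (T.2.2.1 : ℚ) := by
  have hp : (0 : ℚ) < p.den := Nat.cast_pos.2 p.den_pos
  have key (x : ℚ) : p * x = p.num * x / p.den := by
    rw [mul_div_right_comm, Rat.num_div_den]
  rw [key, key, lt_div_iff₀ hp, div_lt_iff₀ hp]
  unfold LiesBetween
  exact_mod_cast Iff.rfl

/-- for every vertex `q` (at path `s`) with boundary triple `(l, q, r) ∈ B`,
the set of vertices of the subtree rooted at `q` is exactly `{p ∈ ℚ : l < p < r}`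
(the comparisons with the possibly infinite bounds `l, r` written in cross-multiplied
form). -/
theorem sb_subtree_eq_interval (s : List Bool) (p : ℚ) :
    (∃ t : List Bool, sbVal (s ++ t) = p) ↔
      (((sbTriple s).1.1 : ℚ) < p * ((sbTriple s).1.2 : ℚ) ∧
        p * (((sbTriple s).2.2.2 : ℚ)) < ((sbTriple s).2.2.1 : ℚ)) := by
  simp only [← liesBetween_num_den_iff, sbVal_eq_iff, sbTriple_append]
  refine ⟨fun ⟨t, ht⟩ => ?_, LiesBetween.exists_foldl⟩
  exact (isUnimodularTriple_sbTriple s).liesBetween_of_foldl_node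
    (Int.natCast_pos.2 p.den_pos) t ht
end

section
/- Let γ: ℚ → Σ be a finite piecewise function and let r ∈ bounds(γ). Then at least one of the edges (r, left(r)) and (r, right(r)) of the Stern–Brocot tree is a break link of γ. -/
lemma sbTriple_append_false (s : List Bool) :
    sbTriple (s ++ [false]) =
      ((sbTriple s).1, mediant (sbTriple s).1 (sbTriple s).2.1, (sbTriple s).2.1) := by
  simp [sbTriple, sbStep]

lemma sbTriple_append_true (s : List Bool) :
    sbTriple (s ++ [true]) =
      ((sbTriple s).2.1, mediant (sbTriple s).2.1 (sbTriple s).2.2, (sbTriple s).2.2) := by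
  simp [sbTriple, sbStep]

/-- Denominators along the tree are nonnegative (positive at nodes), and the cross products of a
node with its two boundaries are positive. -/
lemma sbTriple_invariant (s : List Bool) :
    0 ≤ (sbTriple s).1.2 ∧ 0 < (sbTriple s).2.1.2 ∧ 0 ≤ (sbTriple s).2.2.2 ∧
      (sbTriple s).1.1 * (sbTriple s).2.1.2 < (sbTriple s).2.1.1 * (sbTriple s).1.2 ∧
      (sbTriple s).2.1.1 * (sbTriple s).2.2.2 < (sbTriple s).2.2.1 * (sbTriple s).2.1.2 := by
  induction s using List.reverseRecOn with
  | nil => simp [sbTriple]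
  | append_singleton s d ih =>
    obtain ⟨h1, h2, h3, h4, h5⟩ := ih
    cases d
    · rw [sbTriple_append_false]
      refine ⟨h1, ?_, h2.le, ?_, ?_⟩ <;> simp only [mediant] <;> linarith
    · rw [sbTriple_append_true]
      refine ⟨h2.le, ?_, h3, ?_, ?_⟩ <;> simp only [mediant] <;> linarith

lemma sbVal_append_false_lt (s : List Bool) : sbVal (s ++ [false]) < sbVal s := by
  obtain ⟨h1, h2, -, h4, -⟩ := sbTriple_invariant s
  simp only [sbVal, sbNode, sbTriple_append_false, mediant]
  rw [div_lt_div_iff₀ (by exact_mod_cast (by linarith)) (by exact_mod_cast h2)]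
  exact_mod_cast (by linarith)

lemma sbVal_lt_append_true (s : List Bool) : sbVal s < sbVal (s ++ [true]) := by
  obtain ⟨-, h2, h3, -, h5⟩ := sbTriple_invariant s
  simp only [sbVal, sbNode, sbTriple_append_true, mediant]
  rw [div_lt_div_iff₀ (by exact_mod_cast h2) (by exact_mod_cast (by linarith))]
  exact_mod_cast (by linarith)

/-- A fraction strictly inside the boundaries of a non-root node is found below that node. -/
lemma exists_sbNode_cross_eq_of_mem (p q : ℤ) (n : ℕ) (s : List Bool)
    (hm : (sbTriple s).2.1 = mediant (sbTriple s).1 (sbTriple s).2.2)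
    (hl : (sbTriple s).1.1 * q < p * (sbTriple s).1.2)
    (hr : p * (sbTriple s).2.2.2 < (sbTriple s).2.2.1 * q)
    (hn : (p * (sbTriple s).1.2 - (sbTriple s).1.1 * q) +
      ((sbTriple s).2.2.1 * q - p * (sbTriple s).2.2.2) ≤ n) :
    ∃ t, (sbNode t).1 * q = p * (sbNode t).2 := by
  induction n generalizing s with
  | zero => push_cast at hn; linarith
  | succ n ih =>
    push_cast at hn
    have hm1 : (sbTriple s).2.1.1 = (sbTriple s).1.1 + (sbTriple s).2.2.1 := by rw [hm]; rfl
    have hm2 : (sbTriple s).2.1.2 = (sbTriple s).1.2 + (sbTriple s).2.2.2 := by rw [hm]; rfl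
    rcases lt_trichotomy ((sbTriple s).2.1.1 * q) (p * (sbTriple s).2.1.2) with h | h | h
    · refine ih (s ++ [true]) ?_ ?_ ?_ ?_ <;> rw [sbTriple_append_true]
      · exact h
      · exact hr
      · simp only [hm1, hm2]; linarith
    · exact ⟨s, h⟩
    · refine ih (s ++ [false]) ?_ ?_ ?_ ?_ <;> rw [sbTriple_append_false]
      · exact hl
      · exact h
      · simp only [hm1, hm2]; linarith

/-- Every rational number is a vertex of the Stern–Brocot tree. -/
lemma sbVal_surjective : Function.Surjective sbVal := by
  intro r
  obtain ⟨t, ht⟩ : ∃ t, (sbNode t).1 * (r.den : ℤ) = r.num * (sbNode t).2 := by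
    rcases lt_trichotomy r.num 0 with h | h | h
    · refine exists_sbNode_cross_eq_of_mem r.num r.den _ [false] ?_ ?_ ?_ (Int.self_le_toNat _)
      all_goals simp [sbTriple, sbStep, mediant, h, r.den_pos]
    · exact ⟨[], by simp [sbNode, sbTriple, h]⟩
    · refine exists_sbNode_cross_eq_of_mem r.num r.den _ [true] ?_ ?_ ?_ (Int.self_le_toNat _)
      all_goals simp [sbTriple, sbStep, mediant, h, r.den_pos]
  refine ⟨t, ?_⟩
  have hd : (0 : ℤ) < (sbNode t).2 := (sbTriple_invariant t).2.1
  rw [← Rat.num_div_den r, sbVal, div_eq_div_iff (by exact_mod_cast hd.ne') (by simp)]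
  exact_mod_cast ht

/-- A monochromatic closed interval meets only one piece of the canonical representation. -/
lemma IsCanonicalRep.eq_of_monochromatic_Icc {S : Type*} {γ : ℚ → S} {P : List (Set ℚ)}
    (hP : IsCanonicalRep γ P) {x y : ℚ} (hxy : x ≤ y) (hmono : Monochromatic γ (Set.Icc x y))
    {J K : Set ℚ} (hJ : J ∈ P) (hK : K ∈ P) (hx : x ∈ J) (hy : y ∈ K) : J = K := by
  obtain ⟨⟨hint, hlt, -⟩, -, hch⟩ := hP
  obtain ⟨i, hi, rfl⟩ := List.mem_iff_getElem.1 hJ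
  obtain ⟨j, hj, rfl⟩ := List.mem_iff_getElem.1 hK
  rw [List.pairwise_iff_getElem] at hlt
  have hch' := List.isChain_iff_getElem.1 hch
  rcases lt_trichotomy i j with h | h | h
  · exfalso
    have key : ∃ z ∈ P[i + 1], z ≤ y := by
      rcases (Nat.succ_le_of_lt h).eq_or_lt with rfl | h'
      · exact ⟨y, hy, le_rfl⟩
      · obtain ⟨z, hz⟩ := (hint P[i + 1] (List.getElem_mem _)).1
        exact ⟨z, hz, (hlt _ _ _ _ h' z hz y hy).le⟩
    obtain ⟨z, hz, hzy⟩ := key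
    have hxz := (hlt i (i + 1) _ (by omega) (by omega) x hx z hz).le
    exact hch' i (by omega) x hx z hz (hmono x ⟨le_rfl, hxy⟩ z ⟨hxz, hzy⟩)
  · subst h; rfl
  · exact absurd (hlt j i hj hi h y hy x hx) hxy.not_gt

/-- A bound of `γ` has no neighbourhood on which `γ` is constant. -/
lemma IsBound.not_monochromatic_Icc {S : Type*} {γ : ℚ → S} {r a b : ℚ} (hr : IsBound γ r)
    (ha : a < r) (hb : r < b) : ¬ Monochromatic γ (Set.Icc a b) := by
  intro hmono
  obtain ⟨P, hP, I, hI, h⟩ := hr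
  rcases h with h | h
  · obtain ⟨z, hz, hrz, hzb⟩ := h.exists_between hb
    obtain ⟨J, hJ, haJ⟩ := hP.1.2.2 a
    have hJI := hP.eq_of_monochromatic_Icc (ha.le.trans hrz)
      (fun p hp q hq => hmono p ⟨hp.1, hp.2.trans hzb.le⟩ q ⟨hq.1, hq.2.trans hzb.le⟩) hJ hI haJ hz
    exact (h.1 (hJI ▸ haJ)).not_gt ha
  · obtain ⟨z, hz, haz, hzr⟩ := h.exists_between ha
    obtain ⟨J, hJ, hbJ⟩ := hP.1.2.2 b
    have hJI := hP.eq_of_monochromatic_Icc (hzr.trans hb.le)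
      (fun p hp q hq => hmono p ⟨haz.le.trans hp.1, hp.2⟩ q ⟨haz.le.trans hq.1, hq.2⟩) hI hJ hz hbJ
    exact (h.1 (hJI ▸ hbJ)).not_gt hb


/-- if `γ : ℚ → Σ` is a finite piecewise function and `r ∈ bounds(γ)`,
then at least one of the edges `(r, left(r))`, `(r, right(r))` of the Stern–Brocot
tree is a break link of `γ`. (`false` = L, `true` = R.) -/
theorem bound_has_break_link_child {S : Type*} [Finite S]
    (γ : ℚ → S) (hγ : FinitePW γ) (r : ℚ) (hr : IsBound γ r) :
    ∃ s : List Bool, sbVal s = r ∧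
      (IsBreakLink γ r (sbVal (s ++ [false])) ∨ IsBreakLink γ r (sbVal (s ++ [true]))) := by
  obtain ⟨s, rfl⟩ := sbVal_surjective r
  refine ⟨s, rfl, ?_⟩
  have ha := sbVal_append_false_lt s
  have hb := sbVal_lt_append_true s
  by_contra hcon
  simp only [IsBreakLink, not_or, not_and, not_not] at hcon
  have hl := (hcon.1 ⟨s, false, rfl, rfl⟩).2
  have hu := (hcon.2 ⟨s, true, rfl, rfl⟩).2
  rw [Set.uIcc_of_ge ha.le] at hl
  rw [Set.uIcc_of_le hb.le] at hu
  have hconst : ∀ p ∈ Set.Icc (sbVal (s ++ [false])) (sbVal (s ++ [true])), γ p = γ (sbVal s) := by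
    intro p hp
    rcases le_total p (sbVal s) with h | h
    · exact hl p ⟨hp.1, h⟩ _ ⟨ha.le, le_rfl⟩
    · exact hu p ⟨h, hp.2⟩ _ ⟨le_rfl, hb.le⟩
  exact hr.not_monochromatic_Icc ha hb fun p hp q hq => (hconst p hp).trans (hconst q hq).symm
end
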